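/- Let n ≥ 3 be an integer, m = n − 1, and ρ = 1/m, so that the trajectory equation becomes dx/dz = G(x,z) with G(x,z) = x·z / [−(m−1)(1−x²) + (m−3)·x·z]. Then there exists a differentiable function x̂ : (0, ∞) → ℝ such that x̂′(z) = G(x̂(z), z) for all z > 0, 0 ≤ x̂(z) ≤ 1 for all z > 0, and x̂(z) → 1 as z → 0⁺. -/

import Mathlib

/-- The right-hand side of the trajectory ODE for `ρ = 1/m`:
`G(x,z) = x z / (-(m-1)(1-x²) + (m-3) x z)`. -/
noncomputable def einsteinGcigar (m x z : ℝ) : ℝ :=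
  x * z / (-((m - 1) * (1 - x ^ 2)) + (m - 3) * x * z)

open Set Filter Topology NNReal

section SingularODE

/-- Solutions of an ODE whose right-hand side is antitone in the state do not move apart. -/
lemma abs_sub_le_of_antitone_field {f : ℝ → ℝ → ℝ} {a b : ℝ} {y w : ℝ → ℝ}
    (hf : ∀ s ∈ Icc a b, Antitone (f s))
    (hy : ∀ s ∈ Icc a b, HasDerivWithinAt y (f s (y s)) (Icc a b) s)
    (hw : ∀ s ∈ Icc a b, HasDerivWithinAt w (f s (w s)) (Icc a b) s)
    {s : ℝ} (hs : s ∈ Icc a b) : |y s - w s| ≤ |y a - w a| := by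
  have hd : ∀ s ∈ Icc a b, HasDerivWithinAt (fun s ↦ (y s - w s) ^ 2)
      (2 * (y s - w s) * (f s (y s) - f s (w s))) (Icc a b) s := fun s hs ↦ by
    simpa using ((hy s hs).fun_sub (hw s hs)).fun_pow 2
  have hanti : AntitoneOn (fun s ↦ (y s - w s) ^ 2) (Icc a b) := by
    refine antitoneOn_of_hasDerivWithinAt_nonpos (convex_Icc a b)
      (fun s hs ↦ (hd s hs).continuousWithinAt)
      (fun s hs ↦ (hd s (interior_subset hs)).mono interior_subset) fun s hs ↦ ?_
    rcases le_total (y s) (w s) with h | h <;>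
      have := hf s (interior_subset hs) h <;> nlinarith
  exact sq_le_sq.mp (hanti (left_mem_Icc.2 (hs.1.trans hs.2)) hs hs.1)

/-- Global existence on a compact interval for a bounded, globally Lipschitz right-hand side. -/
lemma exists_hasDerivWithinAt_Icc_of_bounded {f : ℝ → ℝ → ℝ} {a b : ℝ} (hab : a ≤ b) (x₀ : ℝ)
    {K L : ℝ≥0} (hlip : ∀ s ∈ Icc a b, LipschitzWith K (f s))
    (hcont : ∀ x, ContinuousOn (f · x) (Icc a b))
    (hbd : ∀ s ∈ Icc a b, ∀ x, |f s x| ≤ L) :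
    ∃ y : ℝ → ℝ, y a = x₀ ∧ ∀ s ∈ Icc a b, HasDerivWithinAt y (f s (y s)) (Icc a b) s := by
  have hpl : IsPicardLindelof f (⟨a, left_mem_Icc.2 hab⟩ : Icc a b) x₀
      (L * (b - a).toNNReal) 0 L K :=
    { lipschitzOnWith := fun s hs ↦ (hlip s hs).lipschitzOnWith
      continuousOn := fun x _ ↦ hcont x
      norm_le := fun s hs x _ ↦ hbd s hs x
      mul_max_le := by simp [hab] }
  exact hpl.exists_eq_forall_mem_Icc_hasDerivWithinAt₀

/-- A solution emanating from `0` at the possibly singular time `0`, for a right-hand side that is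
antitone and locally uniformly Lipschitz in the state at positive times and bounded near time `0`.
It is the pullback limit of the solutions started at small positive times. -/
lemma exists_hasDerivAt_tendsto_zero {f : ℝ → ℝ → ℝ}
    (hanti : ∀ s > 0, Antitone (f s))
    (hlip : ∀ a > 0, ∀ b, ∃ K : ℝ≥0, ∀ s ∈ Icc a b, LipschitzWith K (f s))
    (hcont : ∀ x, ContinuousOn (f · x) (Ioi 0))
    (hbd : ∀ b, ∃ L : ℝ≥0, ∀ s ∈ Ioc 0 b, ∀ x, |f s x| ≤ L) :
    ∃ z : ℝ → ℝ, (∀ s > 0, HasDerivAt z (f s (z s)) s) ∧ Tendsto z (𝓝[>] 0) (𝓝 0) := by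
  have hex : ∀ a > 0, ∀ b, a ≤ b → ∀ x₀, ∃ y : ℝ → ℝ, y a = x₀ ∧
      ∀ s ∈ Icc a b, HasDerivWithinAt y (f s (y s)) (Icc a b) s := fun a ha b hab x₀ ↦ by
    obtain ⟨K, hK⟩ := hlip a ha b
    obtain ⟨L, hL⟩ := hbd b
    exact exists_hasDerivWithinAt_Icc_of_bounded hab x₀ hK
      (fun x ↦ (hcont x).mono fun s hs ↦ ha.trans_le hs.1)
      fun s hs ↦ hL s ⟨ha.trans_le hs.1, hs.2⟩
  have hdecr : ∀ {y w : ℝ → ℝ} {a b a₁ b₁ a₂ b₂ : ℝ}, 0 < a → a₁ ≤ a → b ≤ b₁ → a₂ ≤ a → b ≤ b₂ →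
      (∀ s ∈ Icc a₁ b₁, HasDerivWithinAt y (f s (y s)) (Icc a₁ b₁) s) →
      (∀ s ∈ Icc a₂ b₂, HasDerivWithinAt w (f s (w s)) (Icc a₂ b₂) s) →
      ∀ s ∈ Icc a b, |y s - w s| ≤ |y a - w a| := fun ha h₁ h₂ h₃ h₄ hy hw s hs ↦
    abs_sub_le_of_antitone_field (fun s hs ↦ hanti s (ha.trans_le hs.1))
      (fun s hs ↦ (hy s (Icc_subset_Icc h₁ h₂ hs)).mono (Icc_subset_Icc h₁ h₂))
      (fun s hs ↦ (hw s (Icc_subset_Icc h₃ h₄ hs)).mono (Icc_subset_Icc h₃ h₄)) hs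
  let a : ℕ → ℝ := fun k ↦ 1 / ((k : ℝ) + 1)
  let b : ℕ → ℝ := fun k ↦ (k : ℝ) + 1
  have ha : ∀ k, 0 < a k := fun k ↦ Nat.one_div_pos_of_nat
  have hb : ∀ k, 1 ≤ b k := fun k ↦ by simp [b]
  have ha1 : ∀ k, a k ≤ 1 := fun k ↦ by
    simpa [a] using inv_le_one_of_one_le₀ (hb k)
  have ha_anti : ∀ {i j}, i ≤ j → a j ≤ a i := fun h ↦ Nat.one_div_le_one_div h
  have hb_mono : ∀ {i j}, i ≤ j → b i ≤ b j := fun h ↦ by simp [b, h]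
  have ha_lim : Tendsto a atTop (𝓝 0) := tendsto_one_div_add_atTop_nhds_zero_nat
  have hb_lim : Tendsto b atTop atTop :=
    tendsto_atTop_add_const_right _ _ tendsto_natCast_atTop_atTop
  choose y hy0 hy using fun k ↦ hex (a k) (ha k) (b k) ((ha1 k).trans (hb k)) 0
  obtain ⟨L, hL⟩ := hbd 1
  have hsmall : ∀ k, ∀ t ∈ Icc (a k) 1, |y k t| ≤ L * t := fun k t ht ↦ by
    have := norm_image_sub_le_of_norm_deriv_le_segment' (C := L)
      (fun x hx ↦ (hy k x (Icc_subset_Icc_right (hb k) hx)).mono (Icc_subset_Icc_right (hb k)))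
      (fun x hx ↦ hL x ⟨(ha k).trans_le hx.1, hx.2.le⟩ _) t ht
    rw [hy0, sub_zero, Real.norm_eq_abs] at this
    exact this.trans (mul_le_mul_of_nonneg_left (by linarith [ha k]) L.2)
  have hcauchy : ∀ s > 0, CauchySeq fun k ↦ y k s := fun s hs ↦ by
    refine Metric.cauchySeq_iff'.2 fun ε hε ↦ ?_
    have hlim : Tendsto (fun k ↦ 2 * (L * a k)) atTop (𝓝 0) := by
      simpa using (ha_lim.const_mul (L : ℝ)).const_mul 2
    obtain ⟨N, h₁, h₂, h₃⟩ := ((hlim.eventually_lt_const hε).and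
      ((ha_lim.eventually_le_const hs).and (hb_lim.eventually_ge_atTop s))).exists
    refine ⟨N, fun k hk ↦ ?_⟩
    have h := hdecr (ha N) (ha_anti hk) (hb_mono hk) le_rfl le_rfl (hy k) (hy N) s ⟨h₂, h₃⟩
    have h' := hsmall k (a N) ⟨ha_anti hk, ha1 N⟩
    rw [hy0 N, sub_zero] at h
    rw [Real.dist_eq]
    linarith [abs_nonneg (y k (a N))]
  choose! z hz using fun s (hs : s > 0) ↦ cauchySeq_tendsto_of_complete (hcauchy s hs)
  refine ⟨z, fun s hs ↦ ?_, ?_⟩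
  · obtain ⟨w, hw0, hw⟩ := hex (s / 2) (by positivity) (2 * s) (by linarith) (z (s / 2))
    have hzw : ∀ t ∈ Icc (s / 2) (2 * s), z t = w t := fun t ht ↦ by
      refine tendsto_nhds_unique (hz t (by linarith [ht.1])) (tendsto_iff_dist_tendsto_zero.2 ?_)
      have h0 := tendsto_iff_dist_tendsto_zero.1 (hz (s / 2) (by linarith))
      refine squeeze_zero' (Eventually.of_forall fun _ ↦ dist_nonneg) ?_ h0
      filter_upwards [ha_lim.eventually_le_const (half_pos hs), hb_lim.eventually_ge_atTop (2 * s)]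
        with k h₁ h₂
      rw [← hw0, Real.dist_eq, Real.dist_eq]
      exact hdecr (half_pos hs) h₁ h₂ le_rfl le_rfl (hy k) hw t ht
    have hmem : Icc (s / 2) (2 * s) ∈ 𝓝 s := Icc_mem_nhds (by linarith) (by linarith)
    rw [hzw s (mem_of_mem_nhds hmem)]
    exact ((hw s (mem_of_mem_nhds hmem)).hasDerivAt hmem).congr_of_eventuallyEq
      (eventually_of_mem hmem hzw)
  · have hle : ∀ᶠ t in 𝓝[>] (0 : ℝ), |z t| ≤ L * t := by
      filter_upwards [Ioo_mem_nhdsGT zero_lt_one] with t ht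
      refine le_of_tendsto (hz t ht.1).abs ?_
      filter_upwards [ha_lim.eventually_le_const ht.1] with k hk
      exact hsmall k t ⟨hk, ht.2.le⟩
    refine squeeze_zero_norm' hle ?_
    have : Tendsto (fun t : ℝ ↦ (L : ℝ) * t) (𝓝 0) (𝓝 (L * 0)) := by
      exact (continuous_const.mul continuous_id).tendsto 0
    simpa using this.mono_left nhdsWithin_le_nhds

/-- Barrier principle on `(0, ∞)`: a function that tends to `0` at `0⁺` and decreases wherever it is
positive is nonpositive. -/
lemma nonpos_of_tendsto_zero_of_deriv_neg {g g' : ℝ → ℝ}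
    (hg : ∀ s > 0, HasDerivAt g (g' s) s) (h0 : Tendsto g (𝓝[>] 0) (𝓝 0))
    (hneg : ∀ s > 0, 0 < g s → g' s < 0) {s : ℝ} (hs : 0 < s) : g s ≤ 0 := by
  refine le_of_forall_gt_imp_ge_of_dense fun c hc ↦ ?_
  obtain ⟨t, htc, ht⟩ := ((h0.eventually_lt_const hc).and (Ioo_mem_nhdsGT hs)).exists
  exact image_le_of_deriv_right_lt_deriv_boundary' (f := g) (f' := g') (B := fun _ ↦ c)
    (B' := fun _ ↦ 0) (fun x hx ↦ (hg x (ht.1.trans_le hx.1)).continuousAt.continuousWithinAt)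
    (fun x hx ↦ (hg x (ht.1.trans_le hx.1)).hasDerivWithinAt) htc.le continuousOn_const
    (fun x _ ↦ hasDerivWithinAt_const x _ c)
    (fun x hx hgx ↦ hneg x (ht.1.trans_le hx.1) (hgx ▸ hc)) ⟨ht.2.le, le_rfl⟩

end SingularODE

section InverseTrajectory

open Real

/-- The trajectory equation solved for `z` as a function of `s = -log x`, with the denominator
truncated at the lower barrier `log (1 + s)`. -/
noncomputable def cigarField (m s z : ℝ) : ℝ :=
  -((m - 3) * exp (-s)) + (m - 1) * (1 - exp (-s) ^ 2) / max z (log (1 + s))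

lemma log_one_add_pos {s : ℝ} (hs : 0 < s) : 0 < log (1 + s) := log_pos (by linarith)

lemma exp_neg_le_inv_one_add {s : ℝ} (hs : 0 < s) : exp (-s) ≤ (1 + s)⁻¹ := by
  rw [exp_neg]
  exact inv_anti₀ (by linarith) (by linarith [add_one_le_exp s])

/-- The key estimate making `log (1 + s)` a lower barrier. -/
lemma one_add_mul_inv_le_div_log {s : ℝ} (hs : 0 < s) :
    (1 + exp (-s)) * (1 + s)⁻¹ ≤ (1 - exp (-s) ^ 2) / log (1 + s) := by
  have hx := exp_pos (-s)
  have hxp := exp_neg_le_inv_one_add hs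
  have hlog : log (1 + s) ≤ s := by linarith [log_le_sub_one_of_pos (show 0 < 1 + s by linarith)]
  have hp : 0 < (1 + s)⁻¹ := by positivity
  have hsp : s * (1 + s)⁻¹ = 1 - (1 + s)⁻¹ := by field_simp; ring
  rw [le_div_iff₀ (log_one_add_pos hs)]
  calc (1 + exp (-s)) * (1 + s)⁻¹ * log (1 + s) ≤ (1 + exp (-s)) * (1 + s)⁻¹ * s := by gcongr
    _ = (1 + exp (-s)) * (1 - (1 + s)⁻¹) := by rw [← hsp]; ring
    _ ≤ (1 + exp (-s)) * (1 - exp (-s)) := by gcongr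
    _ = 1 - exp (-s) ^ 2 := by ring

lemma one_sub_exp_neg_sq_pos {s : ℝ} (hs : 0 < s) : 0 < 1 - exp (-s) ^ 2 := by
  have h1 : exp (-s) < 1 := exp_lt_one_iff.2 (by linarith)
  nlinarith [exp_pos (-s)]

lemma cigarField_antitone {m s : ℝ} (hm : 2 ≤ m) (hs : 0 < s) : Antitone (cigarField m s) := by
  intro z w hzw
  have hB := one_sub_exp_neg_sq_pos hs
  have hl := log_one_add_pos hs
  have hm1 : 0 ≤ m - 1 := by linarith
  have hz : 0 < max z (log (1 + s)) := lt_max_of_lt_right hl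
  unfold cigarField
  gcongr

lemma cigarField_lipschitz {m : ℝ} (hm : 2 ≤ m) {a : ℝ} (ha : 0 < a) (b : ℝ) :
    ∃ K : ℝ≥0, ∀ s ∈ Icc a b, LipschitzWith K (cigarField m s) := by
  have hla := log_one_add_pos ha
  refine ⟨⟨(m - 1) / log (1 + a) ^ 2, div_nonneg (by linarith) (sq_nonneg _)⟩, fun s hs ↦ ?_⟩
  have hs0 : 0 < s := ha.trans_le hs.1
  have hB := one_sub_exp_neg_sq_pos hs0
  have hls : log (1 + a) ≤ log (1 + s) := log_le_log (by linarith) (by linarith [hs.1])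
  refine LipschitzWith.of_dist_le_mul fun z w ↦ ?_
  have hz : log (1 + a) ≤ max z (log (1 + s)) := hls.trans (le_max_right _ _)
  have hw : log (1 + a) ≤ max w (log (1 + s)) := hls.trans (le_max_right _ _)
  have hmax : |max w (log (1 + s)) - max z (log (1 + s))| ≤ |z - w| := by
    rw [abs_sub_comm z w]; exact abs_max_sub_max_le_abs _ _ _
  have hz0 := hla.trans_le hz
  have hw0 := hla.trans_le hw
  have heq : cigarField m s z - cigarField m s w =
      (m - 1) * (1 - exp (-s) ^ 2) * (max w (log (1 + s)) - max z (log (1 + s))) /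
        (max z (log (1 + s)) * max w (log (1 + s))) := by
    unfold cigarField
    field_simp
    ring
  rw [Real.dist_eq, Real.dist_eq, heq, abs_div, abs_mul, abs_of_pos (mul_pos hz0 hw0),
    abs_of_nonneg (mul_nonneg (by linarith : 0 ≤ m - 1) hB.le)]
  change _ ≤ (m - 1) / log (1 + a) ^ 2 * |z - w|
  rw [div_mul_eq_mul_div]
  have hm1 : 0 ≤ m - 1 := by linarith
  have hB1 : (m - 1) * (1 - exp (-s) ^ 2) ≤ m - 1 := by nlinarith [sq_nonneg (exp (-s))]
  have hden : log (1 + a) ^ 2 ≤ max z (log (1 + s)) * max w (log (1 + s)) := by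
    rw [sq]; gcongr
  gcongr

lemma cigarField_continuousOn (m x : ℝ) : ContinuousOn (cigarField m · x) (Ioi 0) := by
  intro s hs
  have hs : 0 < s := hs
  have h1 : (1 + s) ≠ 0 := by linarith
  have h2 : max x (log (1 + s)) ≠ 0 := (lt_max_of_lt_right (log_one_add_pos hs)).ne'
  have hlog : ContinuousAt (fun s : ℝ ↦ log (1 + s)) s := by fun_prop (disch := assumption)
  have hmax : ContinuousAt (fun s : ℝ ↦ max x (log (1 + s))) s := continuousAt_const.max hlog
  refine ContinuousAt.continuousWithinAt ?_
  unfold cigarField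
  exact (by fun_prop : ContinuousAt (fun s : ℝ ↦ -((m - 3) * exp (-s))) s).add
    ((by fun_prop : ContinuousAt (fun s : ℝ ↦ (m - 1) * (1 - exp (-s) ^ 2)) s).div hmax h2)

lemma cigarField_bounded {m : ℝ} (hm : 2 ≤ m) (b : ℝ) :
    ∃ L : ℝ≥0, ∀ s ∈ Ioc 0 b, ∀ x, |cigarField m s x| ≤ L := by
  refine ⟨(m + (m - 1) * (2 * (1 + b))).toNNReal, fun s ⟨hs, hsb⟩ x ↦ ?_⟩
  refine le_trans ?_ (le_coe_toNNReal _)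
  have hx := exp_pos (-s)
  have hx1 : exp (-s) < 1 := exp_lt_one_iff.2 (by linarith)
  have hB := one_sub_exp_neg_sq_pos hs
  have hl := log_one_add_pos hs
  have hm1 : 0 ≤ m - 1 := by linarith
  have hmax : 0 < max x (log (1 + s)) := lt_max_of_lt_right hl
  have hBs : 1 - exp (-s) ^ 2 ≤ 2 * s := by nlinarith [add_one_le_exp (-s)]
  have hlog : s * (1 + s)⁻¹ ≤ log (1 + s) := by
    have h := one_sub_inv_le_log_of_pos (show 0 < 1 + s by linarith)
    have hsp : s * (1 + s)⁻¹ = 1 - (1 + s)⁻¹ := by field_simp; ring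
    rwa [hsp]
  have hq : (1 - exp (-s) ^ 2) / max x (log (1 + s)) ≤ 2 * (1 + b) := by
    calc _ ≤ (2 * s) / (s * (1 + s)⁻¹) := by
          gcongr; exact hlog.trans (le_max_right _ _)
      _ = 2 * (1 + s) := by field_simp
      _ ≤ _ := by gcongr
  have hq0 : 0 ≤ (1 - exp (-s) ^ 2) / max x (log (1 + s)) := by positivity
  have hmul := mul_le_mul_of_nonneg_left hq hm1
  have hmul0 := mul_nonneg hm1 hq0
  unfold cigarField
  rw [mul_div_assoc, abs_le]
  constructor <;> nlinarith

/-- The inverse trajectory: `z` as a function of `s = -log x`. -/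
lemma exists_inverse_trajectory {m : ℝ} (hm : 2 ≤ m) :
    ∃ z : ℝ → ℝ, Tendsto z (𝓝[>] 0) (𝓝 0) ∧ ∀ s > 0, log (1 + s) ≤ z s ∧
      z s ≤ exp s - exp (-s) ∧
      HasDerivAt z (-((m - 3) * exp (-s)) + (m - 1) * (1 - exp (-s) ^ 2) / z s) s := by
  obtain ⟨z, hz, hz0⟩ := exists_hasDerivAt_tendsto_zero (fun s hs ↦ cigarField_antitone hm hs)
    (fun a ha b ↦ cigarField_lipschitz hm ha b) (cigarField_continuousOn m) (cigarField_bounded hm)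
  have hm1 : 0 ≤ m - 1 := by linarith
  have hlow : ∀ s > 0, log (1 + s) ≤ z s := fun s hs ↦ by
    refine sub_nonpos.1 (nonpos_of_tendsto_zero_of_deriv_neg
      (g := fun s ↦ log (1 + s) - z s) (g' := fun s ↦ (1 + s)⁻¹ - cigarField m s (z s))
      (fun s hs ↦ ?_) ?_ (fun s hs hpos ↦ ?_) hs)
    · have h1 : HasDerivAt (fun s : ℝ ↦ 1 + s) 1 s := by simpa using (hasDerivAt_id s).const_add 1
      simpa using (h1.log (by linarith)).fun_sub (hz s hs)
    · have hc : ContinuousAt (fun s : ℝ ↦ log (1 + s)) 0 := by fun_prop (disch := norm_num)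
      simpa using (hc.tendsto.mono_left nhdsWithin_le_nhds).sub hz0
    · have hx := exp_pos (-s)
      have hxp := exp_neg_le_inv_one_add hs
      have hp : 0 < (1 + s)⁻¹ := by positivity
      have hkey := mul_le_mul_of_nonneg_left (one_add_mul_inv_le_div_log hs) hm1
      have hzl : z s ≤ log (1 + s) := by linarith
      simp only [cigarField, max_eq_right hzl, mul_div_assoc]
      nlinarith [mul_pos hx hp, mul_nonneg (by linarith : 0 ≤ m - 2) (sub_nonneg.2 hxp),
        mul_nonneg (by linarith : 0 ≤ m - 2) (mul_pos hx hp).le]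
  refine ⟨z, hz0, fun s hs ↦ ⟨hlow s hs, ?_, ?_⟩⟩
  · refine sub_nonpos.1 (nonpos_of_tendsto_zero_of_deriv_neg
      (g := fun s ↦ z s - (exp s - exp (-s)))
      (g' := fun s ↦ cigarField m s (z s) - (exp s + exp (-s)))
      (fun s hs ↦ ?_) ?_ (fun s hs hpos ↦ ?_) hs)
    · have h1 : HasDerivAt (fun s : ℝ ↦ exp (-s)) (-exp (-s)) s := by
        simpa using (hasDerivAt_neg s).exp
      simpa using (hz s hs).fun_sub ((hasDerivAt_exp s).fun_sub h1)
    · have hc : Continuous fun s : ℝ ↦ exp s - exp (-s) := by fun_prop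
      simpa using hz0.sub ((hc.tendsto 0).mono_left nhdsWithin_le_nhds)
    · have hx := exp_pos (-s)
      have hx1 : exp (-s) < 1 := exp_lt_one_iff.2 (by linarith)
      have he1 : 1 < exp s := one_lt_exp_iff.2 hs
      have hmul : exp s * exp (-s) = 1 := by rw [← exp_add]; simp
      have hV : 0 < exp s - exp (-s) := by linarith
      have hquot : (1 - exp (-s) ^ 2) / z s ≤ exp (-s) := by
        rw [div_le_iff₀ (by linarith)]
        nlinarith
      have := mul_le_mul_of_nonneg_left hquot hm1
      simp only [cigarField, max_eq_left (hlow s hs), mul_div_assoc]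
      linarith
  · have h := hz s hs
    rwa [cigarField, max_eq_left (hlow s hs)] at h

lemma inverse_trajectory_deriv_pos {m s z : ℝ} (hm : 2 ≤ m) (hz : 0 < z)
    (hzu : z ≤ exp s - exp (-s)) :
    0 < -((m - 3) * exp (-s)) + (m - 1) * (1 - exp (-s) ^ 2) / z := by
  have hx := exp_pos (-s)
  have hmul : exp s * exp (-s) = 1 := by rw [← exp_add]; simp
  have hquot : exp (-s) ≤ (1 - exp (-s) ^ 2) / z := by
    rw [le_div_iff₀ hz]
    nlinarith
  have := mul_le_mul_of_nonneg_left hquot (by linarith : 0 ≤ m - 1)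
  rw [mul_div_assoc]
  linarith

/-- The increasing bijection of the line that agrees with a positive strictly increasing function
on `(0, ∞)` and with the identity on `(-∞, 0]`. -/
lemma exists_orderIso_of_strictMonoOn_Ioi {z : ℝ → ℝ} (hmono : StrictMonoOn z (Ioi 0))
    (hcont : ContinuousOn z (Ioi 0)) (h0 : Tendsto z (𝓝[>] 0) (𝓝 0))
    (htop : Tendsto z atTop atTop) (hpos : ∀ s > 0, 0 < z s) :
    ∃ e : ℝ ≃o ℝ, e 0 = 0 ∧ ∀ s > 0, e s = z s := by
  let g : ℝ → ℝ := fun s ↦ if s ≤ 0 then s else z s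
  have hg_nonpos : ∀ s ≤ 0, g s = s := fun s hs ↦ if_pos hs
  have hg_pos : ∀ s > 0, g s = z s := fun s hs ↦ if_neg (not_le.2 hs)
  have hg : StrictMono g := fun s t hst ↦ by
    rcases le_or_gt t 0 with ht | ht
    · rwa [hg_nonpos t ht, hg_nonpos s (hst.le.trans ht)]
    · rcases le_or_gt s 0 with hs | hs
      · rw [hg_nonpos s hs, hg_pos t ht]
        exact hs.trans_lt (hpos t ht)
      · rw [hg_pos s hs, hg_pos t ht]
        exact hmono hs ht hst
  have hsurj : Function.Surjective g := fun y ↦ by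
    rcases le_or_gt y 0 with hy | hy
    · exact ⟨y, hg_nonpos y hy⟩
    · obtain ⟨a, hay, ha⟩ := ((h0.eventually_lt_const hy).and self_mem_nhdsWithin).exists
      obtain ⟨b, hby, hab⟩ := ((htop.eventually_ge_atTop y).and (eventually_ge_atTop a)).exists
      obtain ⟨c, hc, hcy⟩ := intermediate_value_Icc hab
        (hcont.mono fun t ht ↦ lt_of_lt_of_le ha ht.1) ⟨hay.le, hby⟩
      exact ⟨c, (hg_pos c (lt_of_lt_of_le ha hc.1)).trans hcy⟩
  exact ⟨hg.orderIsoOfSurjective g hsurj, hg_nonpos 0 le_rfl, hg_pos⟩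

end InverseTrajectory

/-- For `ρ = 1/(n-1)` there is a solution `x̂` of `x' = G(x, ·)` on `(0, ∞)` with
`0 ≤ x̂ ≤ 1` and `x̂(z) → 1` as `z → 0⁺` (the cigar-type soliton trajectory). -/
theorem exists_cigar_solution (n : ℕ) (hn : 3 ≤ n) (m ρ : ℝ) (hm : m = (n : ℝ) - 1)
    (hρ : ρ = 1 / m) :
    ∃ x : ℝ → ℝ,
      (∀ z > (0 : ℝ), HasDerivAt x (einsteinGcigar m (x z) z) z) ∧
      (∀ z > (0 : ℝ), 0 ≤ x z ∧ x z ≤ 1) ∧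
      Filter.Tendsto x (nhdsWithin 0 (Set.Ioi 0)) (nhds 1) := by
  have hm2 : 2 ≤ m := by
    have : (3 : ℝ) ≤ n := by exact_mod_cast hn
    linarith
  obtain ⟨z, hz0, hz⟩ := exists_inverse_trajectory hm2
  have hpos : ∀ s > 0, 0 < z s := fun s hs ↦ (log_one_add_pos hs).trans_le (hz s hs).1
  have hderiv_pos := fun s (hs : s > 0) ↦
    inverse_trajectory_deriv_pos hm2 (hpos s hs) (hz s hs).2.1
  have hcont : ContinuousOn z (Ioi 0) :=
    fun s hs ↦ (hz s hs).2.2.continuousAt.continuousWithinAt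
  have hmono : StrictMonoOn z (Ioi 0) :=
    strictMonoOn_of_deriv_pos (convex_Ioi 0) hcont fun s hs ↦ by
      rw [interior_Ioi] at hs
      rw [(hz s hs).2.2.deriv]
      exact hderiv_pos s hs
  have htop : Tendsto z atTop atTop :=
    tendsto_atTop_mono' _ (eventually_atTop.2 ⟨1, fun s hs ↦ (hz s (by linarith)).1⟩)
      (Real.tendsto_log_atTop.comp (tendsto_atTop_add_const_left _ 1 tendsto_id))
  obtain ⟨e, he0, he⟩ := exists_orderIso_of_strictMonoOn_Ioi hmono hcont hz0 htop hpos
  have hsymm0 : e.symm 0 = 0 := by rw [← he0, e.symm_apply_apply, he0]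
  have hsymm_pos : ∀ y > 0, 0 < e.symm y := fun y hy ↦ hsymm0 ▸ e.symm.strictMono hy
  refine ⟨fun y ↦ Real.exp (-e.symm y), fun y hy ↦ ?_, fun y hy ↦
    ⟨(Real.exp_pos _).le, Real.exp_le_one_iff.2 (by linarith [hsymm_pos y hy])⟩, ?_⟩
  · have hs := hsymm_pos y hy
    have hzy : z (e.symm y) = y := by rw [← he _ hs, e.apply_symm_apply]
    have hd := (hz _ hs).2.2
    have hd0 := hderiv_pos _ hs
    rw [hzy] at hd hd0
    have hde : HasDerivAt e _ (e.symm y) :=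
      hd.congr_of_eventuallyEq (eventually_of_mem (Ioi_mem_nhds hs) he)
    have hinv := hde.of_local_left_inverse e.symm.continuous.continuousAt hd0.ne'
      (Eventually.of_forall e.apply_symm_apply)
    have hx := hinv.fun_neg.exp
    set x := Real.exp (-e.symm y) with hx_def
    refine hx.congr_deriv ?_
    have hden : -((m - 3) * x) + (m - 1) * (1 - x ^ 2) / y =
        -(-((m - 1) * (1 - x ^ 2)) + (m - 3) * x * y) / y := by
      field_simp
      ring
    rw [hden, einsteinGcigar, inv_div, div_neg, neg_neg, mul_div_assoc]
  · have hc : Continuous fun y ↦ Real.exp (-e.symm y) :=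
      Real.continuous_exp.comp e.symm.continuous.neg
    simpa [hsymm0] using (hc.tendsto 0).mono_left nhdsWithin_le_nhds
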